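/- Let B be an additive category and let K^b(B) be the bounded homotopy category of complexes over B. Let K^b(B)^{w≤0} (respectively K^b(B)^{w≥0}) be the class of complexes that are homotopy equivalent to complexes concentrated in degrees ≤ 0 (respectively ≥ 0). Then this pair of classes defines a bounded weight structure on K^b(B) (the 'stupid' weight structure), whose heart is the Karoubi-closure of B in K^b(B); in particular, if B is idempotent complete then the heart is equivalent to B. -/

import Mathlib

open CategoryTheory CategoryTheory.Limits CategoryTheory.Pretriangulated

universe v u v₁ u₁

namespace Paper

/-- `X` is a retract of `Y`: the identity of `X` factors through `Y`. -/
def IsRetractOf {C : Type u₁} [Category.{v₁} C] (X Y : C) : Prop :=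
  ∃ (i : X ⟶ Y) (r : Y ⟶ X), i ≫ r = 𝟙 X

section Generic

variable {C : Type u₁} [Category.{v₁} C] [HasZeroObject C] [Preadditive C] [HasShift C ℤ]
  [∀ n : ℤ, (shiftFunctor C n).Additive] [Pretriangulated C]

/-- The pair `(le, ge)` is a weight structure on the (strictly full triangulated)
subcategory of `C` whose objects form the class `T`. -/
def IsWeightStructureOn (T le ge : Set C) : Prop :=
  le ⊆ T ∧ ge ⊆ T ∧
  (∀ ⦃X Y : C⦄, X ∈ T → IsRetractOf X Y → Y ∈ le → X ∈ le) ∧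
  (∀ ⦃X Y : C⦄, X ∈ T → IsRetractOf X Y → Y ∈ ge → X ∈ ge) ∧
  (∀ ⦃X Y : C⦄, X ∈ le → Y ∈ le →
    ∀ b : BinaryBicone X Y, Nonempty b.IsBilimit → b.pt ∈ T → b.pt ∈ le) ∧
  (∀ ⦃X Y : C⦄, X ∈ ge → Y ∈ ge →
    ∀ b : BinaryBicone X Y, Nonempty b.IsBilimit → b.pt ∈ T → b.pt ∈ ge) ∧
  (∀ ⦃X : C⦄, X ∈ le → X⟦(1 : ℤ)⟧ ∈ le) ∧
  (∀ ⦃X : C⦄, X ∈ ge → X⟦(-1 : ℤ)⟧ ∈ ge) ∧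
  (∀ ⦃X Y : C⦄, X ∈ ge → Y ∈ le → ∀ f : X ⟶ Y⟦(1 : ℤ)⟧, f = 0) ∧
  (∀ X, X ∈ T → ∃ (A B : C) (f : X ⟶ A) (g : A ⟶ B) (h : B ⟶ X⟦(1 : ℤ)⟧),
    A ∈ le ∧ B ∈ ge ∧ Triangle.mk f g h ∈ distTriang C)

/-- The weight structure `(le, ge)` on the subcategory with objects `T` is bounded. -/
def BoundedOn (T le ge : Set C) : Prop :=
  ∀ X ∈ T, (∃ i : ℤ, X⟦i⟧ ∈ le) ∧ (∃ j : ℤ, X⟦j⟧ ∈ ge)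

end Generic

variable (B : Type u) [Category.{v} B] [Preadditive B] [HasZeroObject B] [HasBinaryBiproducts B]

/-- The functor sending an object of `B` to the associated complex concentrated in
degree `0`, viewed in the homotopy category `K(B)`. -/
noncomputable def singleK : B ⥤ HomotopyCategory B (ComplexShape.up ℤ) :=
  HomologicalComplex.single B (ComplexShape.up ℤ) 0 ⋙
    HomotopyCategory.quotient B (ComplexShape.up ℤ)

/-- The class of objects of `K^b(B) ⊆ K(B)`: objects homotopy equivalent to a
bounded complex. -/
def boundedClass : Set (HomotopyCategory B (ComplexShape.up ℤ)) :=
  {X | ∃ Y : CochainComplex B ℤ,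
    Nonempty (X ≅ (HomotopyCategory.quotient B (ComplexShape.up ℤ)).obj Y) ∧
    ∃ a b : ℤ, ∀ n : ℤ, n < a ∨ b < n → IsZero (Y.X n)}

/-- `K^b(B)^{w≤0}`: objects of `K^b(B)` that are homotopy equivalent to a complex
concentrated in degrees `≤ 0`. -/
def stupidLe : Set (HomotopyCategory B (ComplexShape.up ℤ)) :=
  boundedClass B ∩ {X | ∃ Y : CochainComplex B ℤ,
    Nonempty (X ≅ (HomotopyCategory.quotient B (ComplexShape.up ℤ)).obj Y) ∧
    ∀ n : ℤ, 0 < n → IsZero (Y.X n)}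

/-- `K^b(B)^{w≥0}`: objects of `K^b(B)` that are homotopy equivalent to a complex
concentrated in degrees `≥ 0`. -/
def stupidGe : Set (HomotopyCategory B (ComplexShape.up ℤ)) :=
  boundedClass B ∩ {X | ∃ Y : CochainComplex B ℤ,
    Nonempty (X ≅ (HomotopyCategory.quotient B (ComplexShape.up ℤ)).obj Y) ∧
    ∀ n : ℤ, n < 0 → IsZero (Y.X n)}

variable {B}

open Category

set_option linter.unusedSectionVars false

/-- `X` is homotopy equivalent to a complex which vanishes in all degrees belonging to `Z`. -/
def HasModel (Z : Set ℤ) (X : HomotopyCategory B (ComplexShape.up ℤ)) : Prop :=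
  ∃ Y : CochainComplex B ℤ,
    Nonempty (X ≅ (HomotopyCategory.quotient B (ComplexShape.up ℤ)).obj Y) ∧
    ∀ n ∈ Z, IsZero (Y.X n)

namespace HasModel

variable {Z W : Set ℤ} {X Y : HomotopyCategory B (ComplexShape.up ℤ)}

lemma mono (h : HasModel Z X) (hWZ : W ⊆ Z) : HasModel W X := by
  obtain ⟨K, e, hK⟩ := h
  exact ⟨K, e, fun n hn ↦ hK n (hWZ hn)⟩

lemma of_iso (h : HasModel Z X) (e : Y ≅ X) : HasModel Z Y := by
  obtain ⟨K, ⟨e'⟩, hK⟩ := h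
  exact ⟨K, ⟨e ≪≫ e'⟩, hK⟩

lemma shift (h : HasModel Z X) (k : ℤ) : HasModel {n | n + k ∈ Z} (X⟦k⟧) := by
  obtain ⟨K, ⟨e⟩, hK⟩ := h
  exact ⟨K⟦k⟧, ⟨(shiftFunctor _ k).mapIso e ≪≫ (((HomotopyCategory.quotient B _).commShiftIso k).app K).symm⟩,
    fun n hn ↦ hK _ hn⟩

/-- Morphisms vanish when the degreewise supports of the models are disjoint. -/
lemma hom_eq_zero (hX : HasModel Z X) (hY : HasModel W Y) (h : ∀ n, n ∈ Z ∨ n ∈ W)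
    (f : X ⟶ Y) : f = 0 := by
  obtain ⟨K, ⟨e⟩, hK⟩ := hX
  obtain ⟨L, ⟨e'⟩, hL⟩ := hY
  obtain ⟨φ, hφ⟩ := (HomotopyCategory.quotient B _).map_surjective (e.inv ≫ f ≫ e'.hom)
  have hφ0 : φ = 0 := by
    ext n
    exact (h n).elim (fun hn ↦ (hK n hn).eq_of_src _ _) (fun hn ↦ (hL n hn).eq_of_tgt _ _)
  rw [hφ0, Functor.map_zero] at hφ
  rw [← cancel_epi e.inv, ← cancel_mono e'.hom, assoc, ← hφ]
  simp

lemma obj₃ {T : Triangle (HomotopyCategory B (ComplexShape.up ℤ))} (hT : T ∈ distTriang _)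
    (h₁ : HasModel Z T.obj₁) (h₂ : HasModel W T.obj₂) :
    HasModel {n | n + 1 ∈ Z ∧ n ∈ W} T.obj₃ := by
  obtain ⟨K, ⟨e₁⟩, hK⟩ := h₁
  obtain ⟨L, ⟨e₂⟩, hL⟩ := h₂
  obtain ⟨φ, hφ⟩ := (HomotopyCategory.quotient B _).map_surjective (e₁.inv ≫ T.mor₁ ≫ e₂.hom)
  let e := isoTriangleOfIso₁₂ _ _ hT
    (HomotopyCategory.mappingCone_triangleh_distinguished φ) e₁ e₂
      (by
        change T.mor₁ ≫ e₂.hom = e₁.hom ≫ (HomotopyCategory.quotient B _).map φ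
        rw [hφ, e₁.hom_inv_id_assoc])
  refine ⟨CochainComplex.mappingCone φ, ⟨Triangle.π₃.mapIso e⟩, fun n hn ↦ ?_⟩
  rw [IsZero.iff_id_eq_zero, CochainComplex.mappingCone.ext_from_iff φ (n + 1) n rfl]
  exact ⟨(hK _ hn.1).eq_of_src _ _, (hL _ hn.2).eq_of_src _ _⟩

lemma obj₂ {T : Triangle (HomotopyCategory B (ComplexShape.up ℤ))} (hT : T ∈ distTriang _)
    (h₁ : HasModel Z T.obj₁) (h₃ : HasModel W T.obj₃) :
    HasModel (Z ∩ W) T.obj₂ :=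
  (obj₃ (inv_rot_of_distTriang _ hT) (h₃.shift (-1)) h₁).mono
    fun n hn ↦ ⟨by simpa using hn.2, hn.1⟩

lemma obj₁ {T : Triangle (HomotopyCategory B (ComplexShape.up ℤ))} (hT : T ∈ distTriang _)
    (h₂ : HasModel Z T.obj₂) (h₃ : HasModel W T.obj₃) :
    HasModel {n | n ∈ Z ∧ n - 1 ∈ W} T.obj₁ :=
  (obj₂ (inv_rot_of_distTriang _ hT) (h₃.shift (-1)) h₂).mono
    fun _ hn ↦ ⟨hn.2, hn.1⟩

end HasModel

lemma exists_split_isZero (X : B) (P : Prop) : ∃ (T : B) (i : T ⟶ X) (p : X ⟶ T),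
    i ≫ p = 𝟙 T ∧ (P → p ≫ i = 𝟙 X) ∧ (¬ P → IsZero T) ∧ (IsZero X → IsZero T) := by
  by_cases hP : P
  · exact ⟨X, 𝟙 X, 𝟙 X, by simp, by simp, by simp [hP], id⟩
  · have hZ := (HasZeroObject.zero (C := B)).choose_spec
    exact ⟨_, 0, 0, hZ.eq_of_src _ _, fun h ↦ (hP h).elim, fun _ ↦ hZ, fun _ ↦ hZ⟩

/-- The distinguished triangle given by the stupid truncations of a complex. -/
lemma exists_stupid_truncation (K : CochainComplex B ℤ) (m : ℤ) :
    ∃ (L M : CochainComplex B ℤ)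
      (f : (HomotopyCategory.quotient B _).obj L ⟶ (HomotopyCategory.quotient B _).obj K)
      (g : (HomotopyCategory.quotient B _).obj K ⟶ (HomotopyCategory.quotient B _).obj M)
      (h : (HomotopyCategory.quotient B _).obj M ⟶
        ((HomotopyCategory.quotient B _).obj L)⟦(1 : ℤ)⟧),
      Triangle.mk f g h ∈ distTriang _ ∧
      (∀ n, n < m → IsZero (L.X n)) ∧ (∀ n, m ≤ n → IsZero (M.X n)) ∧
      ∀ n, IsZero (K.X n) → IsZero (L.X n) ∧ IsZero (M.X n) := by
  choose T i p hip hpi hT hT' using fun n ↦ exists_split_isZero (K.X n) (m ≤ n)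
  choose U j q hjq hqj hU hU' using fun n ↦ exists_split_isZero (K.X n) (n < m)
  have hi (a b : ℤ) (hab : a + 1 = b) : i a ≫ K.d a b ≫ p b ≫ i b = i a ≫ K.d a b := by
    by_cases hb : m ≤ b
    · rw [hpi b hb, comp_id]
    · exact (hT a (by lia)).eq_of_src _ _
  have hq (a b : ℤ) (hab : a + 1 = b) : q a ≫ j a ≫ K.d a b ≫ q b = K.d a b ≫ q b := by
    by_cases ha : a < m
    · rw [reassoc_of% (hqj a ha)]
    · exact (hU b (by lia)).eq_of_tgt _ _
  let L : CochainComplex B ℤ :=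
    { X := T
      d := fun a b ↦ i a ≫ K.d a b ≫ p b
      shape := fun a b hab ↦ by rw [K.shape a b hab, zero_comp, comp_zero]
      d_comp_d' := fun a b c hab hbc ↦ by
        have := hi a b hab
        simp only [assoc]
        rw [reassoc_of% this, K.d_comp_d_assoc, zero_comp, comp_zero] }
  let M : CochainComplex B ℤ :=
    { X := U
      d := fun a b ↦ j a ≫ K.d a b ≫ q b
      shape := fun a b hab ↦ by rw [K.shape a b hab, zero_comp, comp_zero]
      d_comp_d' := fun a b c hab hbc ↦ by
        simp only [assoc]
        rw [hq b c hbc, K.d_comp_d_assoc, zero_comp, comp_zero] }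
  let f : L ⟶ K :=
    { f := i
      comm' := fun a b hab ↦ by
        change _ = (i a ≫ K.d a b ≫ p b) ≫ i b
        simp only [assoc]
        exact (hi a b hab).symm }
  let g : K ⟶ M :=
    { f := q
      comm' := fun a b hab ↦ hq a b hab }
  have hfg : f ≫ g = 0 := by
    ext n
    by_cases hn : m ≤ n
    · exact (hU n (by lia)).eq_of_tgt _ _
    · exact (hT n hn).eq_of_src _ _
  let S : ShortComplex (CochainComplex B ℤ) := ShortComplex.mk f g hfg
  let σ (n : ℤ) : (S.map (HomologicalComplex.eval B _ n)).Splitting :=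
    { r := p n
      s := j n
      f_r := hip n
      s_g := hjq n
      id := by
        change p n ≫ i n + q n ≫ j n = 𝟙 (K.X n)
        by_cases hn : m ≤ n
        · rw [hpi n hn, (hU n (by lia)).eq_of_tgt (q n) 0, zero_comp, add_zero]
        · rw [hqj n (by lia), (hT n hn).eq_of_tgt (p n) 0, zero_comp, zero_add] }
  refine ⟨L, M, (HomotopyCategory.quotient B _).map f, (HomotopyCategory.quotient B _).map g, _,
    (HomotopyCategory.distinguished_iff_iso_trianglehOfDegreewiseSplit _).2
      ⟨S, σ, ⟨Iso.refl _⟩⟩, fun n hn ↦ hT n (by lia), fun n hn ↦ hU n (by lia),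
    fun n hn ↦ ⟨hT' n hn, hU' n hn⟩⟩

/-- The middle term of a distinguished triangle may be replaced by an isomorphic object. -/
lemma distTriang_of_iso₂ {C : Type u₁} [Category.{v₁} C] [HasZeroObject C] [Preadditive C]
    [HasShift C ℤ] [∀ n : ℤ, (shiftFunctor C n).Additive] [Pretriangulated C]
    {X Y Y' Z : C} {f : X ⟶ Y} {g : Y ⟶ Z} {h : Z ⟶ X⟦(1 : ℤ)⟧}
    (hT : Triangle.mk f g h ∈ distTriang C) (e : Y' ≅ Y) :
    Triangle.mk (f ≫ e.inv) (e.hom ≫ g) h ∈ distTriang C := by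
  refine isomorphic_distinguished _ hT _
    (Triangle.isoMk _ _ (Iso.refl X) e (Iso.refl Z) ?_ ?_ ?_)
  · change (f ≫ e.inv) ≫ e.hom = 𝟙 X ≫ f
    simp
  · change (e.hom ≫ g) ≫ 𝟙 Z = e.hom ≫ g
    simp
  · change h ≫ (𝟙 X)⟦(1 : ℤ)⟧' = 𝟙 Z ≫ h
    simp

lemma HasModel.exists_truncation {Z : Set ℤ} {X : HomotopyCategory B (ComplexShape.up ℤ)}
    (hX : HasModel Z X) (m : ℤ) :
    ∃ (L M : HomotopyCategory B (ComplexShape.up ℤ)) (f : L ⟶ X) (g : X ⟶ M)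
      (h : M ⟶ L⟦(1 : ℤ)⟧), Triangle.mk f g h ∈ distTriang _ ∧
      HasModel (Z ∪ Set.Iio m) L ∧ HasModel (Z ∪ Set.Ici m) M := by
  obtain ⟨K, ⟨e⟩, hK⟩ := hX
  obtain ⟨L, M, f, g, h, hT, hL, hM, hLM⟩ := exists_stupid_truncation K m
  refine ⟨_, _, f ≫ e.inv, e.hom ≫ g, h, distTriang_of_iso₂ hT e,
    ⟨L, ⟨Iso.refl _⟩, ?_⟩, ⟨M, ⟨Iso.refl _⟩, ?_⟩⟩
  · rintro n (hn | hn)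
    exacts [(hLM n (hK n hn)).1, hL n hn]
  · rintro n (hn | hn)
    exacts [(hLM n (hK n hn)).2, hM n hn]

/-- A distinguished triangle with vanishing connecting morphism is split, hence
its outer terms can be exchanged. -/
lemma exists_distTriang_swap {C : Type u₁} [Category.{v₁} C] [HasZeroObject C] [Preadditive C]
    [HasShift C ℤ] [∀ n : ℤ, (shiftFunctor C n).Additive] [Pretriangulated C]
    {T : Triangle C} (hT : T ∈ distTriang C) (h₀ : T.mor₃ = 0) :
    ∃ (f : T.obj₃ ⟶ T.obj₂) (g : T.obj₂ ⟶ T.obj₁) (h : T.obj₁ ⟶ T.obj₃⟦(1 : ℤ)⟧),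
      Triangle.mk f g h ∈ distTriang C := by
  obtain ⟨e, -⟩ := exists_iso_binaryBiproduct_of_distTriang T hT h₀
  let e' : T.obj₂ ≅ T.obj₃ ⊞ T.obj₁ := e ≪≫ biprod.braiding _ _
  exact ⟨_, _, _, distTriang_of_iso₂ (binaryBiproductTriangle_distinguished T.obj₃ T.obj₁) e'⟩

lemma HasModel.Ioi_of_hom_eq_zero (X : HomotopyCategory B (ComplexShape.up ℤ)) (n : ℕ)
    (hX : HasModel (Set.Ioi (n : ℤ)) X)
    (h : ∀ L, HasModel (Set.Iio 1) L → ∀ f : L ⟶ X, f = 0) :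
    HasModel (Set.Ioi 0) X := by
  induction n with
  | zero => simpa using hX
  | succ n ih =>
    obtain ⟨L, M, f, g, δ, hT, hL, hM⟩ := hX.exists_truncation 1
    have hf : f = 0 := h L (hL.mono Set.subset_union_right) f
    obtain ⟨a, b, c, hT'⟩ := exists_distTriang_swap (rot_of_distTriang _ hT) (by
      change -(f⟦(1 : ℤ)⟧') = 0
      rw [hf, Functor.map_zero, neg_zero])
    refine ih ((HasModel.obj₃ hT' (hL.shift 1) hM).mono fun k hk ↦ ?_)
    simp only [Set.mem_Ioi] at hk
    exact ⟨Or.inl (by simp; lia), Or.inr (by simp; lia)⟩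

lemma HasModel.Iio_of_hom_eq_zero (X : HomotopyCategory B (ComplexShape.up ℤ)) (n : ℕ)
    (hX : HasModel (Set.Iio (-n : ℤ)) X)
    (h : ∀ M, HasModel (Set.Ici 0) M → ∀ f : X ⟶ M, f = 0) :
    HasModel (Set.Iio 0) X := by
  induction n with
  | zero => simpa using hX
  | succ n ih =>
    obtain ⟨L, M, f, g, δ, hT, hL, hM⟩ := hX.exists_truncation 0
    have hg : g = 0 := h M (hM.mono Set.subset_union_right) g
    obtain ⟨a, b, c, hT'⟩ := exists_distTriang_swap (inv_rot_of_distTriang _ hT) (by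
      subst hg
      exact zero_comp)
    refine ih ((HasModel.obj₁ hT' hL (hM.shift (-1))).mono fun k hk ↦ ?_)
    simp only [Set.mem_Iio] at hk
    exact ⟨Or.inr (by simp; lia), Or.inl (by simp; lia)⟩

lemma mem_boundedClass_iff {X : HomotopyCategory B (ComplexShape.up ℤ)} :
    X ∈ boundedClass B ↔ ∃ a b : ℤ, HasModel (Set.Iio a ∪ Set.Ioi b) X :=
  ⟨fun ⟨Y, e, a, b, h⟩ ↦ ⟨a, b, Y, e, h⟩, fun ⟨a, b, Y, e, h⟩ ↦ ⟨Y, e, a, b, h⟩⟩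

lemma mem_stupidLe_iff {X : HomotopyCategory B (ComplexShape.up ℤ)} :
    X ∈ stupidLe B ↔ X ∈ boundedClass B ∧ HasModel (Set.Ioi 0) X := Iff.rfl

lemma mem_stupidGe_iff {X : HomotopyCategory B (ComplexShape.up ℤ)} :
    X ∈ stupidGe B ↔ X ∈ boundedClass B ∧ HasModel (Set.Iio 0) X := Iff.rfl

lemma shift_mem_boundedClass {X : HomotopyCategory B (ComplexShape.up ℤ)}
    (hX : X ∈ boundedClass B) (k : ℤ) : X⟦k⟧ ∈ boundedClass B := by
  obtain ⟨a, b, h⟩ := mem_boundedClass_iff.1 hX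
  refine mem_boundedClass_iff.2 ⟨a - k, b - k, (h.shift k).mono fun n hn ↦ ?_⟩
  simp only [Set.mem_union, Set.mem_Iio, Set.mem_Ioi, Set.mem_ofPred_eq] at hn ⊢
  lia

lemma mem_stupidLe_of_isRetractOf {X Y : HomotopyCategory B (ComplexShape.up ℤ)}
    (hX : X ∈ boundedClass B) (h : IsRetractOf X Y) (hY : HasModel (Set.Ioi 0) Y) :
    X ∈ stupidLe B := by
  obtain ⟨i, r, hir⟩ := h
  obtain ⟨a, b, h⟩ := mem_boundedClass_iff.1 hX
  refine ⟨hX, HasModel.Ioi_of_hom_eq_zero X b.toNat (h.mono fun n hn ↦ Or.inr ?_)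
    fun L hL f ↦ ?_⟩
  · simp only [Set.mem_Ioi] at hn ⊢
    lia
  · rw [← comp_id f, ← hir, ← assoc, hL.hom_eq_zero hY (fun n ↦ ?_) (f ≫ i), zero_comp]
    simp only [Set.mem_Iio, Set.mem_Ioi]
    lia

lemma mem_stupidGe_of_isRetractOf {X Y : HomotopyCategory B (ComplexShape.up ℤ)}
    (hX : X ∈ boundedClass B) (h : IsRetractOf X Y) (hY : HasModel (Set.Iio 0) Y) :
    X ∈ stupidGe B := by
  obtain ⟨i, r, hir⟩ := h
  obtain ⟨a, b, h⟩ := mem_boundedClass_iff.1 hX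
  refine ⟨hX, HasModel.Iio_of_hom_eq_zero X (-a).toNat (h.mono fun n hn ↦ Or.inl ?_)
    fun M hM f ↦ ?_⟩
  · simp only [Set.mem_Iio] at hn ⊢
    lia
  · rw [← id_comp f, ← hir, assoc, hY.hom_eq_zero hM (fun n ↦ ?_) (r ≫ f), comp_zero]
    simp only [Set.mem_Iio, Set.mem_Ici]
    lia

lemma HasModel.bicone_pt {Z : Set ℤ} {X Y : HomotopyCategory B (ComplexShape.up ℤ)}
    (hX : HasModel Z X) (hY : HasModel Z Y) (b : BinaryBicone X Y) (hb : b.IsBilimit) :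
    HasModel Z b.pt :=
  ((HasModel.obj₂ (binaryBiproductTriangle_distinguished X Y) hX hY).mono
    (by simp)).of_iso (biprod.uniqueUpToIso X Y hb)

lemma hasModel_singleK (b : B) : HasModel (Set.Iio 0 ∪ Set.Ioi 0) ((singleK B).obj b) :=
  ⟨_, ⟨Iso.refl _⟩, fun n hn ↦ HomologicalComplex.isZero_single_obj_X _ _ _ _ (by
    simp only [Set.mem_union, Set.mem_Iio, Set.mem_Ioi] at hn
    lia)⟩

lemma singleK_mem_boundedClass (b : B) : (singleK B).obj b ∈ boundedClass B :=
  mem_boundedClass_iff.2 ⟨0, 0, hasModel_singleK b⟩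

lemma HasModel.exists_iso_singleK {X : HomotopyCategory B (ComplexShape.up ℤ)}
    (hX : HasModel (Set.Iio 0 ∪ Set.Ioi 0) X) :
    ∃ b : B, Nonempty (X ≅ (singleK B).obj b) := by
  obtain ⟨K, ⟨e⟩, hK⟩ := hX
  have : K.IsStrictlyGE 0 := (K.isStrictlyGE_iff 0).2 fun n hn ↦ hK n (Or.inl hn)
  have : K.IsStrictlyLE 0 := (K.isStrictlyLE_iff 0).2 fun n hn ↦ hK n (Or.inr hn)
  obtain ⟨b, ⟨e'⟩⟩ := K.exists_iso_single 0
  exact ⟨b, ⟨e ≪≫ (HomotopyCategory.quotient B _).mapIso e'⟩⟩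

instance : (singleK B).Full := by
  dsimp [singleK]
  infer_instance

instance : (singleK B).Faithful where
  map_injective {X Y} f g h := by
    have ho := HomotopyCategory.homotopyOfEq _ _ h
    apply (HomologicalComplex.single B (ComplexShape.up ℤ) 0).map_injective
    ext
    simpa [dNext, prevD] using ho.comm 0

lemma exists_isRetractOf_singleK {X : HomotopyCategory B (ComplexShape.up ℤ)}
    (h : HasModel (Set.Ioi 0) X) (h' : HasModel (Set.Iio 0) X) :
    ∃ b : B, IsRetractOf X ((singleK B).obj b) := by
  obtain ⟨L, M, f, g, δ, hT, hL, hM⟩ := h.exists_truncation 0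
  have hg : g = 0 := h'.hom_eq_zero hM
    (fun n ↦ (lt_or_ge n 0).imp_right Or.inr) g
  obtain ⟨s, hs⟩ : ∃ s : X ⟶ L, 𝟙 X = s ≫ f := Triangle.coyoneda_exact₂ _ hT (𝟙 X) (by
    change 𝟙 X ≫ g = 0
    rw [hg, comp_zero])
  obtain ⟨b, ⟨e⟩⟩ := (hL.mono (by rw [Set.union_comm])).exists_iso_singleK
  refine ⟨b, s ≫ e.hom, e.inv ≫ f, ?_⟩
  rw [assoc, e.hom_inv_id_assoc, hs]

lemma IsRetractOf.exists_iso_singleK [IsIdempotentComplete B]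
    {X : HomotopyCategory B (ComplexShape.up ℤ)} {b : B}
    (h : IsRetractOf X ((singleK B).obj b)) :
    ∃ b' : B, Nonempty (X ≅ (singleK B).obj b') := by
  obtain ⟨i, r, hir⟩ := h
  obtain ⟨p, hp⟩ := (singleK B).map_surjective (r ≫ i)
  have hpp : p ≫ p = p := (singleK B).map_injective (by
    simp only [Functor.map_comp, hp, assoc, reassoc_of% hir])
  obtain ⟨b', j, q, hjq, hqj⟩ := IsIdempotentComplete.idempotents_split b p hpp
  have hqj' := (singleK B).congr_map hqj
  have hjq' : (singleK B).map j ≫ (singleK B).map q = 𝟙 _ := by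
    rw [← Functor.map_comp, hjq, CategoryTheory.Functor.map_id]
  rw [Functor.map_comp, hp] at hqj'
  refine ⟨b', ⟨i ≫ (singleK B).map q, (singleK B).map j ≫ r, ?_, ?_⟩⟩
  · rw [assoc, reassoc_of% hqj', hir, comp_id, hir]
  · rw [assoc, ← reassoc_of% hqj', hjq', comp_id, hjq']

variable (B)

lemma isWeightStructureOn_stupid :
    IsWeightStructureOn (boundedClass B) (stupidLe B) (stupidGe B) := by
  refine ⟨fun _ h ↦ h.1, fun _ h ↦ h.1, fun X Y hX h hY ↦ mem_stupidLe_of_isRetractOf hX h hY.2,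
    fun X Y hX h hY ↦ mem_stupidGe_of_isRetractOf hX h hY.2,
    fun X Y hX hY b ⟨hb⟩ hT ↦ ⟨hT, HasModel.bicone_pt hX.2 hY.2 b hb⟩,
    fun X Y hX hY b ⟨hb⟩ hT ↦ ⟨hT, HasModel.bicone_pt hX.2 hY.2 b hb⟩,
    fun X hX ↦ mem_stupidLe_iff.2 ⟨shift_mem_boundedClass hX.1 1, ?_⟩,
    fun X hX ↦ mem_stupidGe_iff.2 ⟨shift_mem_boundedClass hX.1 (-1), ?_⟩,
    fun X Y hX hY f ↦ ?_, fun X hX ↦ ?_⟩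
  · refine ((mem_stupidLe_iff.1 hX).2.shift 1).mono fun n hn ↦ ?_
    simp only [Set.mem_Ioi, Set.mem_ofPred_eq] at hn ⊢
    lia
  · refine ((mem_stupidGe_iff.1 hX).2.shift (-1)).mono fun n hn ↦ ?_
    simp only [Set.mem_Iio, Set.mem_ofPred_eq] at hn ⊢
    lia
  · refine (mem_stupidGe_iff.1 hX).2.hom_eq_zero ((mem_stupidLe_iff.1 hY).2.shift 1) (fun n ↦ ?_) f
    simp only [Set.mem_Iio, Set.mem_Ioi, Set.mem_ofPred_eq]
    lia
  · obtain ⟨a, b, h⟩ := mem_boundedClass_iff.1 hX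
    obtain ⟨L, M, f, g, δ, hT, hL, hM⟩ := h.exists_truncation 1
    refine ⟨M, L⟦(1 : ℤ)⟧, g, δ, _, mem_stupidLe_iff.2 ⟨mem_boundedClass_iff.2
      ⟨a, b, hM.mono Set.subset_union_left⟩, hM.mono fun n hn ↦ Or.inr hn⟩,
      mem_stupidGe_iff.2 ⟨shift_mem_boundedClass (mem_boundedClass_iff.2
        ⟨a, b, hL.mono Set.subset_union_left⟩) 1, (hL.shift 1).mono fun n hn ↦ Or.inr ?_⟩,
      rot_of_distTriang _ hT⟩
    simp only [Set.mem_Iio] at hn ⊢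
    lia

lemma boundedOn_stupid : BoundedOn (boundedClass B) (stupidLe B) (stupidGe B) := by
  intro X hX
  obtain ⟨a, b, h⟩ := mem_boundedClass_iff.1 hX
  refine ⟨⟨b, mem_stupidLe_iff.2 ⟨shift_mem_boundedClass hX b,
    (h.shift b).mono fun n hn ↦ Or.inr ?_⟩⟩, ⟨a, mem_stupidGe_iff.2
      ⟨shift_mem_boundedClass hX a, (h.shift a).mono fun n hn ↦ Or.inl ?_⟩⟩⟩
  · simp only [Set.mem_Ioi] at hn ⊢
    lia
  · simp only [Set.mem_Iio] at hn ⊢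
    lia

lemma stupid_heart_eq : stupidLe B ∩ stupidGe B =
    boundedClass B ∩ {X | ∃ b : B, IsRetractOf X ((singleK B).obj b)} := by
  ext X
  constructor
  · exact fun h ↦ ⟨h.1.1, exists_isRetractOf_singleK h.1.2 h.2.2⟩
  · rintro ⟨hX, b, h⟩
    exact ⟨mem_stupidLe_of_isRetractOf hX h ((hasModel_singleK b).mono Set.subset_union_right),
      mem_stupidGe_of_isRetractOf hX h ((hasModel_singleK b).mono Set.subset_union_left)⟩

/-- Remark 1.3.2: for an additive category `B`, the classes of complexes homotopy
equivalent to complexes concentrated in degrees `≤ 0` (resp. `≥ 0`) form a bounded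
('stupid') weight structure on `K^b(B)`, whose heart is the Karoubi-closure of `B`
in `K^b(B)`; if moreover `B` is idempotent complete, the heart consists exactly of
the objects isomorphic to complexes concentrated in degree `0`. -/
theorem stupid_weightStructure :
    IsWeightStructureOn (boundedClass B) (stupidLe B) (stupidGe B) ∧
    BoundedOn (boundedClass B) (stupidLe B) (stupidGe B) ∧
    stupidLe B ∩ stupidGe B =
      boundedClass B ∩ {X | ∃ b : B, IsRetractOf X ((singleK B).obj b)} ∧
    (IsIdempotentComplete B →
      stupidLe B ∩ stupidGe B = {X | ∃ b : B, Nonempty (X ≅ (singleK B).obj b)}) := by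
  refine ⟨isWeightStructureOn_stupid B, boundedOn_stupid B, stupid_heart_eq B, fun _ ↦ ?_⟩
  rw [stupid_heart_eq]
  ext X
  constructor
  · rintro ⟨-, b, h⟩
    exact h.exists_iso_singleK
  · rintro ⟨b, ⟨e⟩⟩
    obtain ⟨m, n, h⟩ := mem_boundedClass_iff.1 (singleK_mem_boundedClass b)
    exact ⟨mem_boundedClass_iff.2 ⟨m, n, h.of_iso e⟩, b, e.hom, e.inv, e.hom_inv_id⟩

end Paper
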